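/- Let a, b be integers, let i, j ∈ {1, −1}, define f̄_{i,j}(x) := |i·u(x) + a| + |j·v(x) + b| for x ≥ 0, K := |a| + max{|b| + 1, √(1 + D·b²)}, and x₁ := sup{x ∈ [0,∞) : f̄_{i,j}(x) = K}. Then for every x ≥ x₁ one has f̄_{i,j}(x) = f(x) + i·a + j·b where f = u + v, and the restriction f̄_{i,j} : [x₁, ∞) → [K, ∞) is a strictly increasing bijection. -/

import Mathlib

open Set Filter

/-- A continuous function on `[c, ∞)` tending to infinity attains every value above `g c`. -/
theorem exists_ge_eq_of_tendsto_atTop {g : ℝ → ℝ} (hg : Continuous g)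
    (htop : Tendsto g atTop atTop) {c y : ℝ} (hy : g c ≤ y) : ∃ x, c ≤ x ∧ g x = y := by
  obtain ⟨z, hyz, hcz⟩ := ((htop.eventually_ge_atTop y).and (eventually_ge_atTop c)).exists
  obtain ⟨x, hx, hxy⟩ := intermediate_value_Icc hcz hg.continuousOn ⟨hy, hyz⟩
  exact ⟨x, hx.1, hxy⟩

/-- Two functions parametrizing the branch `u ^ 2 - D * v ^ 2 = 1` of a hyperbola, shifted by
`a` and `b`, are simultaneously nonnegative at some point where the shifts sum to
`|a| + max (|b| + 1) √(1 + D * b ^ 2)`. -/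
theorem exists_shift_nonneg_add_eq {u v : ℝ → ℝ} {D : ℝ} (hD : 1 ≤ D)
    (hu : Continuous u) (hv : Continuous v)
    (hum : StrictMonoOn u (Ici 0)) (hvm : StrictMonoOn v (Ici 0))
    (hut : Tendsto u atTop atTop) (hvt : Tendsto v atTop atTop)
    (hu0 : u 0 = 1) (hv0 : v 0 = 0) (hpell : ∀ x, u x ^ 2 = 1 + D * v x ^ 2) (a b : ℝ) :
    ∃ x, 0 ≤ x ∧ 0 ≤ u x + a ∧ 0 ≤ v x + b ∧
      u x + a + (v x + b) = |a| + max (|b| + 1) √(1 + D * b ^ 2) := by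
  have hupos : ∀ x, 0 ≤ x → 1 ≤ u x := fun x hx =>
    hu0 ▸ hum.monotoneOn self_mem_Ici hx hx
  have hvpos : ∀ x, 0 ≤ x → 0 ≤ v x := fun x hx =>
    hv0 ▸ hvm.monotoneOn self_mem_Ici hx hx
  have hsum : Tendsto (fun x => u x + a + (v x + b)) atTop atTop :=
    (tendsto_atTop_add_const_right _ a hut).atTop_add_atTop
      (tendsto_atTop_add_const_right _ b hvt)
  obtain ⟨x₀, hx₀, hua, hvb, hle⟩ : ∃ x, 0 ≤ x ∧ 0 ≤ u x + a ∧ 0 ≤ v x + b ∧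
      u x + a + (v x + b) ≤ |a| + max (|b| + 1) √(1 + D * b ^ 2) := by
    have hl := le_max_left (|b| + 1) √(1 + D * b ^ 2)
    have hr := le_max_right (|b| + 1) √(1 + D * b ^ 2)
    have ha := le_abs_self a
    have ha' := neg_le_abs a
    have hb := le_abs_self b
    rcases le_total 0 (min (u 0 + a) (v 0 + b)) with h | h
    · obtain ⟨h₁, h₂⟩ := le_min_iff.1 h
      exact ⟨0, le_rfl, h₁, h₂, by rw [hu0, hv0]; linarith⟩
    · have htop : Tendsto (fun x => min (u x + a) (v x + b)) atTop atTop :=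
        tendsto_atTop.2 fun y => by
          filter_upwards [(tendsto_atTop_add_const_right _ a hut).eventually_ge_atTop y,
            (tendsto_atTop_add_const_right _ b hvt).eventually_ge_atTop y] with x h₁ h₂
          exact le_min h₁ h₂
      obtain ⟨x, hx, hmin⟩ := exists_ge_eq_of_tendsto_atTop
        ((hu.add continuous_const).min (hv.add continuous_const)) htop h
      simp only [Pi.add_apply] at hmin
      obtain ⟨h₁, h₂⟩ := le_min_iff.1 hmin.ge
      refine ⟨x, hx, h₁, h₂, ?_⟩
      rcases min_choice (u x + a) (v x + b) with h' | h'
      · have hvu : v x ≤ u x := by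
          nlinarith [hpell x, hupos x hx, hvpos x hx, sq_nonneg (v x)]
        linarith
      · have hvx : v x = -b := by linarith
        have hux : u x = √(1 + D * b ^ 2) := by
          rw [← neg_sq b, ← hvx, ← hpell x, Real.sqrt_sq (by linarith [hupos x hx])]
        linarith
  obtain ⟨x, hx, hxK⟩ := exists_ge_eq_of_tendsto_atTop
    ((hu.add continuous_const).add (hv.add continuous_const)) hsum hle
  have hx0 : 0 ≤ x := hx₀.trans hx
  exact ⟨x, hx0, hua.trans (by linarith [hum.monotoneOn hx₀ hx0 hx]),
    hvb.trans (by linarith [hvm.monotoneOn hx₀ hx0 hx]), hxK⟩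

/-- A sign can be moved between the summands inside an absolute value. -/
theorem abs_sign_mul_add {i : ℝ} (hi : i = 1 ∨ i = -1) (x y : ℝ) :
    |i * x + y| = |x + i * y| := by
  rcases hi with rfl | rfl
  · simp
  · rw [← abs_neg]; ring_nf

theorem stmt18 (D : ℤ) (hD : 1 < D) (hDns : ¬ IsSquare D)
    (α β : ℤ) (hα : 0 < α) (hβ : 0 < β)
    (hsol : α ^ 2 - D * β ^ 2 = 1)
    (hmin : ∀ x y : ℤ, x ^ 2 - D * y ^ 2 = 1 →
      1 < (x : ℝ) + (y : ℝ) * Real.sqrt D →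
      (α : ℝ) + (β : ℝ) * Real.sqrt D ≤ (x : ℝ) + (y : ℝ) * Real.sqrt D)
    (u v : ℝ → ℝ)
    (hu : ∀ x : ℝ, 0 ≤ x →
      u x = (((α : ℝ) + (β : ℝ) * Real.sqrt D) ^ x
        + ((α : ℝ) - (β : ℝ) * Real.sqrt D) ^ x) / 2)
    (hv : ∀ x : ℝ, 0 ≤ x →
      v x = (((α : ℝ) + (β : ℝ) * Real.sqrt D) ^ x
        - ((α : ℝ) - (β : ℝ) * Real.sqrt D) ^ x) / (2 * Real.sqrt D))
    (a b : ℤ) (i j : ℝ) (hi : i = 1 ∨ i = -1) (hj : j = 1 ∨ j = -1)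
    (fbar : ℝ → ℝ)
    (hfbar : ∀ x : ℝ, 0 ≤ x → fbar x = |i * u x + (a : ℝ)| + |j * v x + (b : ℝ)|)
    (K : ℝ)
    (hK : K = |(a : ℝ)| + max (|(b : ℝ)| + 1) (Real.sqrt (1 + (D : ℝ) * (b : ℝ) ^ 2)))
    (x₁ : ℝ) (hx₁ : x₁ = sSup {x : ℝ | 0 ≤ x ∧ fbar x = K}) :
    (∀ x : ℝ, x₁ ≤ x → fbar x = u x + v x + i * (a : ℝ) + j * (b : ℝ)) ∧
    StrictMonoOn fbar (Set.Ici x₁) ∧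
    Set.BijOn fbar (Set.Ici x₁) (Set.Ici K) := by
  have hD' : (1 : ℝ) < D := by exact_mod_cast hD
  have hs : 0 < √(D : ℝ) := Real.sqrt_pos.2 (by linarith)
  have hα' : (1 : ℝ) ≤ α := by exact_mod_cast hα
  have hβ' : (0 : ℝ) < β := by exact_mod_cast hβ
  have hsq : √(D : ℝ) ^ 2 = D := Real.sq_sqrt (by linarith)
  have hc : 1 < (α : ℝ) + β * √D := by linarith [mul_pos hβ' hs]
  have hc0 : 0 < (α : ℝ) + β * √D := by linarith
  have hsolR : (α : ℝ) ^ 2 - D * β ^ 2 = 1 := by exact_mod_cast hsol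
  have hconj : (α : ℝ) - β * √D = ((α : ℝ) + β * √D)⁻¹ :=
    eq_inv_of_mul_eq_one_left (by linear_combination hsolR - (β : ℝ) ^ 2 * hsq)
  obtain ⟨L, hL⟩ : ∃ L, L = Real.log ((α : ℝ) + β * √D) := ⟨_, rfl⟩
  have hL0 : 0 < L := hL ▸ Real.log_pos hc
  have hpow : ∀ x : ℝ, ((α : ℝ) + β * √D) ^ x = Real.exp (L * x) := fun x => by
    rw [Real.rpow_def_of_pos hc0, hL]
  have hpow' : ∀ x : ℝ, ((α : ℝ) - β * √D) ^ x = Real.exp (-(L * x)) := fun x => by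
    rw [hconj, Real.inv_rpow hc0.le, hpow, Real.exp_neg]
  replace hu : ∀ x, 0 ≤ x → u x = Real.cosh (L * x) := fun x hx => by
    rw [hu x hx, hpow, hpow', Real.cosh_eq]
  replace hv : ∀ x, 0 ≤ x → v x = Real.sinh (L * x) / √D := fun x hx => by
    rw [hv x hx, hpow, hpow', Real.sinh_eq, div_div]
  have hum : StrictMonoOn (fun x => Real.cosh (L * x)) (Ici 0) := fun x hx y hy hxy =>
    Real.cosh_strictMonoOn (mul_nonneg hL0.le hx) (mul_nonneg hL0.le hy)
      (mul_lt_mul_of_pos_left hxy hL0)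
  have hvm : StrictMono (fun x => Real.sinh (L * x) / √D) := fun x y hxy =>
    div_lt_div_of_pos_right (Real.sinh_strictMono (mul_lt_mul_of_pos_left hxy hL0)) hs
  have hst : Tendsto (fun x => Real.sinh (L * x)) atTop atTop :=
    tendsto_atTop_mono' _ ((eventually_ge_atTop 0).mono fun x hx =>
      Real.self_le_sinh_iff.2 (mul_nonneg hL0.le hx)) (tendsto_id.const_mul_atTop hL0)
  have hut : Tendsto (fun x => Real.cosh (L * x)) atTop atTop :=
    tendsto_atTop_mono (fun x => (Real.sinh_lt_cosh _).le) hst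
  have hvt : Tendsto (fun x => Real.sinh (L * x) / √D) atTop atTop := hst.atTop_div_const hs
  have hcu : Continuous (fun x => Real.cosh (L * x)) := by fun_prop
  have hcv : Continuous (fun x => Real.sinh (L * x) / √D) := by fun_prop
  obtain ⟨z, hz0, hza, hzb, hzK⟩ := exists_shift_nonneg_add_eq (D := (D : ℝ)) hD'.le hcu hcv hum
    (hvm.strictMonoOn _) hut hvt (by simp) (by simp)
    (fun x => by rw [div_pow, hsq, mul_div_cancel₀ _ (by linarith), Real.cosh_sq]; ring)
    (i * a) (j * b)
  have habs : ∀ {s : ℝ}, (s = 1 ∨ s = -1) → ∀ t : ℝ, |s * t| = |t| := by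
    rintro s (rfl | rfl) t <;> simp
  rw [mul_pow, (by rcases hj with rfl | rfl <;> norm_num : j ^ 2 = 1), one_mul, habs hi, habs hj,
    ← hK] at hzK
  obtain ⟨g, hg⟩ : ∃ g : ℝ → ℝ, g = fun x =>
    Real.cosh (L * x) + i * a + (Real.sinh (L * x) / √D + j * b) := ⟨_, rfl⟩
  have hgz : g z = K := by rw [hg]; exact hzK
  have hgm : StrictMonoOn g (Ici z) := fun x hx y hy hxy => by
    have h₁ : Real.cosh (L * x) < Real.cosh (L * y) := hum (hz0.trans hx) (hz0.trans hy) hxy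
    have h₂ : Real.sinh (L * x) / √D < Real.sinh (L * y) / √D := hvm hxy
    simp only [hg]
    linarith
  have hfg : EqOn fbar g (Ici z) := fun x hx => by
    have hx0 : 0 ≤ x := hz0.trans hx
    have h₁ : Real.cosh (L * z) ≤ Real.cosh (L * x) := hum.monotoneOn hz0 hx0 hx
    have h₂ : Real.sinh (L * z) / √D ≤ Real.sinh (L * x) / √D := hvm.monotone hx
    rw [hfbar x hx0, abs_sign_mul_add hi, abs_sign_mul_add hj, hu x hx0, hv x hx0,
      abs_of_nonneg (by linarith), abs_of_nonneg (by linarith), hg]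
  have hfm : StrictMonoOn fbar (Ici z) := hgm.congr hfg.symm
  have hfz : fbar z = K := (hfg self_mem_Ici).trans hgz
  have hxz : x₁ = z := by
    rw [hx₁]
    refine IsGreatest.csSup_eq ⟨⟨hz0, hfz⟩, fun x hx => ?_⟩
    by_contra! h
    exact (hfm self_mem_Ici h.le h).ne (hfz.trans hx.2.symm)
  rw [hxz]
  refine ⟨fun x hx => ?_, hfm, fun x hx => ?_, hfm.injOn, fun y hy => ?_⟩
  · rw [hfg hx, hg, hu x (hz0.trans hx), hv x (hz0.trans hx)]
    ring
  · exact hfz.ge.trans (hfm.monotoneOn self_mem_Ici hx hx)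
  · obtain ⟨x, hx, hxy⟩ := exists_ge_eq_of_tendsto_atTop (g := g) (by rw [hg]; fun_prop)
      (by
        rw [hg]
        exact (tendsto_atTop_add_const_right _ _ hut).atTop_add_atTop
          (tendsto_atTop_add_const_right _ _ hvt))
      (hgz.trans_le hy)
    exact ⟨x, hx, (hfg hx).trans hxy⟩
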